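/- arXiv:1912.03952 — 2 statements merged into one kernel-verified Lean document; each statement's English description precedes it below -/
import Mathlib

section
/- Let k, r ≥ 1 be integers and let X = (X_{j,l}) be uniformly distributed on Δ_k̄, with Y_j = Σ_{l=1}^r X_{j,l}. Then for every 1 ≤ j ≤ k one has E[Y_j] = 1/(jk) and E[Y_j²] = (r+1)/(j² · k · (kr+1)); in particular E[Y_j²] ≤ 2/(j²k²). -/
open MeasureTheory

/-- The uniform probability measure on a set `s` of Hausdorff dimension `d`: the
`d`-dimensional Hausdorff measure restricted to `s`, normalized to total mass `1`. -/
noncomputable def uniformOn {E : Type*} [EMetricSpace E] [MeasurableSpace E] [BorelSpace E]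
    (d : ℝ) (s : Set E) : Measure E :=
  (μH[d] s)⁻¹ • (μH[d] : Measure E).restrict s

section SumZero

variable {ι : Type*} [Fintype ι]

/-- The hyperplane of vectors with zero coordinate sum. -/
def sumZero (ι : Type*) [Fintype ι] : Submodule ℝ (ι → ℝ) :=
  LinearMap.ker (∑ i, LinearMap.proj i : (ι → ℝ) →ₗ[ℝ] ℝ)

theorem mem_sumZero {v : ι → ℝ} : v ∈ sumZero ι ↔ ∑ i, v i = 0 := by
  simp [sumZero]

/-- The barycenter of the standard simplex. -/
noncomputable def barycenter (ι : Type*) [Fintype ι] : ι → ℝ := fun _ => (Fintype.card ι : ℝ)⁻¹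

theorem sum_barycenter [Nonempty ι] : ∑ i, barycenter ι i = 1 := by
  simp [barycenter]

/-- The translate to the hyperplane `∑ i, z i = 1` of a measure on the hyperplane `sumZero ι`. -/
noncomputable def planeMeasure (ρ : Measure (sumZero ι)) : Measure (ι → ℝ) :=
  Measure.map (fun v : sumZero ι => barycenter ι + (v : ι → ℝ)) ρ

theorem measurable_barycenter_add :
    Measurable fun v : sumZero ι => barycenter ι + (v : ι → ℝ) := by
  fun_prop

variable (ρ : Measure (sumZero ι)) [ρ.IsAddHaarMeasure]

theorem map_planeMeasure [Nonempty ι] (A : (ι → ℝ) →ₗ[ℝ] (ι → ℝ)) (hinj : Function.Injective A)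
    (hA : ∀ z, ∑ i, A z i = ∑ i, z i) :
    ∃ c : ENNReal, (planeMeasure ρ).map A = c • planeMeasure ρ := by
  have hmem : ∀ v ∈ sumZero ι, A v ∈ sumZero ι := fun v hv => by
    rw [mem_sumZero] at hv ⊢
    rw [hA, hv]
  let B : sumZero ι →ₗ[ℝ] sumZero ι := A.restrict hmem
  have hB : Function.Injective B := fun v w h => by
    have := congrArg Subtype.val h
    exact Subtype.ext (hinj this)
  have hdet : LinearMap.det B ≠ 0 := by
    have := (LinearEquiv.ofInjectiveEndo B hB).isUnit_det'
    exact this.ne_zero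
  let b : sumZero ι := ⟨A (barycenter ι) - barycenter ι, by
    rw [mem_sumZero]
    simp [Finset.sum_sub_distrib, hA]⟩
  have hAm : Measurable A := A.continuous_of_finiteDimensional.measurable
  have hBm : Measurable B := B.continuous_of_finiteDimensional.measurable
  refine ⟨ENNReal.ofReal |(LinearMap.det B)⁻¹|, ?_⟩
  have key : (A ∘ fun v : sumZero ι => barycenter ι + (v : ι → ℝ)) =
      (fun v : sumZero ι => barycenter ι + (v : ι → ℝ)) ∘ (fun v => b + v) ∘ B := by
    funext v
    simp [b, B]
    abel
  rw [planeMeasure, Measure.map_map hAm measurable_barycenter_add, key,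
    ← Measure.map_map measurable_barycenter_add (by fun_prop),
    ← Measure.map_map (by fun_prop) hBm,
    Measure.map_linearMap_addHaar_eq_smul_addHaar ρ hdet, Measure.map_smul, map_add_left_eq_self,
    Measure.map_smul]

theorem planeMeasure_stdSimplex_ne_zero [Nonempty ι] :
    planeMeasure ρ (stdSimplex ℝ ι) ≠ 0 := by
  rw [planeMeasure, Measure.map_apply measurable_barycenter_add
    (isClosed_stdSimplex ℝ ι).measurableSet]
  have hcont : Continuous fun v : sumZero ι => barycenter ι + (v : ι → ℝ) := by fun_prop
  have hopen : IsOpen {z : ι → ℝ | ∀ i, 0 < z i} := by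
    simp only [Set.ofPred_forall]
    exact isOpen_iInter_of_finite fun i => isOpen_lt continuous_const (continuous_apply i)
  have hpos : 0 < ρ ((fun v : sumZero ι => barycenter ι + (v : ι → ℝ)) ⁻¹'
      {z : ι → ℝ | ∀ i, 0 < z i}) := by
    refine (hopen.preimage hcont).measure_pos ρ ⟨0, fun i => ?_⟩
    simp [barycenter, Fintype.card_pos]
  refine (hpos.trans_le (measure_mono ?_)).ne'
  intro v hv
  refine ⟨fun i => (hv i).le, ?_⟩
  simp only [Pi.add_apply, Finset.sum_add_distrib, mem_sumZero.1 v.2, sum_barycenter, add_zero]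

theorem planeMeasure_stdSimplex_ne_top :
    planeMeasure ρ (stdSimplex ℝ ι) ≠ ⊤ := by
  rw [planeMeasure, Measure.map_apply measurable_barycenter_add
    (isClosed_stdSimplex ℝ ι).measurableSet]
  have hemb : Topology.IsClosedEmbedding fun v : sumZero ι => barycenter ι + (v : ι → ℝ) :=
    (Homeomorph.addLeft (barycenter ι)).isClosedEmbedding.comp
      (Submodule.closed_of_finiteDimensional (sumZero ι)).isClosedEmbedding_subtypeVal
  exact (hemb.isCompact_preimage (isCompact_stdSimplex ℝ ι)).measure_ne_top

theorem planeMeasure_diagonal {p q : ι} (hpq : p ≠ q) :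
    planeMeasure ρ {z | z p = z q} = 0 := by
  classical
  have hm : MeasurableSet {z : ι → ℝ | z p = z q} :=
    measurableSet_eq_fun (measurable_pi_apply p) (measurable_pi_apply q)
  rw [planeMeasure, Measure.map_apply measurable_barycenter_add hm]
  let K : Submodule ℝ (sumZero ι) :=
    LinearMap.ker
      (((LinearMap.proj p : (ι → ℝ) →ₗ[ℝ] ℝ) - LinearMap.proj q) ∘ₗ (sumZero ι).subtype)
  have hK : (fun v : sumZero ι => barycenter ι + (v : ι → ℝ)) ⁻¹' {z | z p = z q} = K := by
    ext v
    simp [K, barycenter, sub_eq_zero]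
  rw [hK]
  refine Measure.addHaar_submodule ρ K fun h => ?_
  let e : sumZero ι := ⟨Pi.single p 1 - Pi.single q 1, by
    rw [mem_sumZero]; simp [Finset.sum_sub_distrib]⟩
  have he : e ∈ K := h ▸ Submodule.mem_top
  simp [K, e, hpq, hpq.symm] at he

end SumZero

section Unfold

variable {ι : Type*}

/-- The linear map stretching the half `z q ≤ z p` of the standard simplex onto the simplex. -/
noncomputable def unfoldMap [DecidableEq ι] (p q : ι) : (ι → ℝ) →ₗ[ℝ] (ι → ℝ) :=
  LinearMap.id + (LinearMap.proj q).smulRight (Pi.single q 1 - Pi.single p 1)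

theorem unfoldMap_apply [DecidableEq ι] (p q : ι) (z : ι → ℝ) :
    unfoldMap p q z = z + z q • (Pi.single q 1 - Pi.single p 1) := rfl

theorem unfoldMap_left [DecidableEq ι] {p q : ι} (hpq : p ≠ q) (z : ι → ℝ) :
    unfoldMap p q z p = z p - z q := by
  simp [unfoldMap_apply, hpq, sub_eq_add_neg]

theorem unfoldMap_right [DecidableEq ι] {p q : ι} (hpq : p ≠ q) (z : ι → ℝ) :
    unfoldMap p q z q = 2 * z q := by
  simp [unfoldMap_apply, hpq.symm, two_mul]

theorem unfoldMap_of_ne [DecidableEq ι] {p q i : ι} (hp : i ≠ p) (hq : i ≠ q) (z : ι → ℝ) :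
    unfoldMap p q z i = z i := by
  simp [unfoldMap_apply, hp, hq]

theorem unfoldMap_injective [DecidableEq ι] {p q : ι} (hpq : p ≠ q) :
    Function.Injective (unfoldMap p q) := by
  intro y z h
  have hq : y q = z q := by
    have := congrFun h q
    rw [unfoldMap_right hpq, unfoldMap_right hpq] at this
    linarith
  rw [unfoldMap_apply, unfoldMap_apply, hq] at h
  exact add_right_cancel h

end Unfold

section Moments

variable {ι : Type*} [Fintype ι]

/-- The uniform distribution on the standard simplex attached to a Haar measure on the
hyperplane of vectors with zero coordinate sum. -/
noncomputable def simplexLaw (ρ : Measure (sumZero ι)) : Measure (ι → ℝ) :=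
  ProbabilityTheory.cond (planeMeasure ρ) (stdSimplex ℝ ι)

theorem ae_mem_stdSimplex (ρ : Measure (sumZero ι)) : ∀ᵐ z ∂simplexLaw ρ, z ∈ stdSimplex ℝ ι :=
  ProbabilityTheory.ae_cond_mem (isClosed_stdSimplex ℝ ι).measurableSet

theorem sum_ite_eq_two_one [DecidableEq ι] (p : ι) :
    ∑ i, (if p = i then (2 : ℝ) else 1) = Fintype.card ι + 1 := by
  have (i : ι) : (if p = i then (2 : ℝ) else 1) = 1 + if p = i then 1 else 0 := by
    split_ifs <;> norm_num
  simp [this, Finset.sum_add_distrib]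

variable (ρ : Measure (sumZero ι)) [ρ.IsAddHaarMeasure]

theorem isProbabilityMeasure_simplexLaw [Nonempty ι] : IsProbabilityMeasure (simplexLaw ρ) :=
  ProbabilityTheory.cond_isProbabilityMeasure_of_finite (planeMeasure_stdSimplex_ne_zero ρ)
    (planeMeasure_stdSimplex_ne_top ρ)

theorem simplexLaw_diagonal {p q : ι} (hpq : p ≠ q) : simplexLaw ρ {z | z p = z q} = 0 :=
  ProbabilityTheory.cond_absolutelyContinuous (planeMeasure_diagonal ρ hpq)

theorem map_restrict_simplexLaw [Nonempty ι] (A : (ι → ℝ) →ₗ[ℝ] (ι → ℝ))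
    (hinj : Function.Injective A) (hA : ∀ z, ∑ i, A z i = ∑ i, z i) (s : Set (ι → ℝ))
    (hs : A ⁻¹' stdSimplex ℝ ι = stdSimplex ℝ ι ∩ s) :
    ((simplexLaw ρ).restrict s).map A = simplexLaw ρ s • simplexLaw ρ := by
  have := isProbabilityMeasure_simplexLaw ρ
  obtain ⟨c, hc⟩ := map_planeMeasure ρ A hinj hA
  have hS := (isClosed_stdSimplex ℝ ι).measurableSet
  have hAm : Measurable A := A.continuous_of_finiteDimensional.measurable
  have key : ((simplexLaw ρ).restrict s).map A = c • simplexLaw ρ := by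
    have hset : s ∩ stdSimplex ℝ ι = A ⁻¹' stdSimplex ℝ ι := by rw [hs, Set.inter_comm]
    rw [simplexLaw, ProbabilityTheory.cond, Measure.restrict_smul,
      Measure.restrict_restrict' hS, hset, Measure.map_smul, ← Measure.restrict_map hAm hS, hc,
      Measure.restrict_smul, smul_comm]
  have huniv := congrArg (fun m => m Set.univ) key
  simp only [Measure.map_apply hAm MeasurableSet.univ, Set.preimage_univ, Measure.restrict_apply_univ,
    Measure.smul_apply, measure_univ, smul_eq_mul, mul_one] at huniv
  rw [key, huniv]

theorem integrable_of_continuous_simplexLaw [Nonempty ι] {f : (ι → ℝ) → ℝ} (hf : Continuous f) :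
    Integrable f (simplexLaw ρ) := by
  have := isProbabilityMeasure_simplexLaw ρ
  obtain ⟨C, hC⟩ := (isCompact_stdSimplex ℝ ι).exists_bound_of_continuousOn hf.continuousOn
  refine Integrable.of_bound hf.aestronglyMeasurable C ?_
  filter_upwards [ae_mem_stdSimplex ρ] with z hz using hC z hz

theorem integral_swap_simplexLaw [Nonempty ι] [DecidableEq ι] (p q : ι) {f : (ι → ℝ) → ℝ}
    (hf : Continuous f) (s : Set (ι → ℝ)) (hs : MeasurableSet s) :
    ∫ z in {z | z ∘ Equiv.swap p q ∈ s}, f (z ∘ Equiv.swap p q) ∂simplexLaw ρ =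
      ∫ z in s, f z ∂simplexLaw ρ := by
  have := isProbabilityMeasure_simplexLaw ρ
  let A : (ι → ℝ) →ₗ[ℝ] (ι → ℝ) := LinearMap.funLeft ℝ ℝ (Equiv.swap p q)
  have hAc : Continuous A := A.continuous_of_finiteDimensional
  have hAm : Measurable A := hAc.measurable
  have h := map_restrict_simplexLaw ρ A
    (LinearMap.funLeft_injective_of_surjective _ _ _ (Equiv.swap p q).surjective)
    (fun z => Equiv.sum_comp (Equiv.swap p q) z) Set.univ (by
      ext z
      simp only [Set.mem_preimage, Set.inter_univ, stdSimplex, Set.mem_ofPred_eq]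
      refine and_congr ?_ (by rw [← Equiv.sum_comp (Equiv.swap p q) z]; rfl)
      exact (Equiv.swap p q).forall_congr_right (q := fun i => 0 ≤ z i))
  rw [Measure.restrict_univ, measure_univ, one_smul] at h
  conv_rhs => rw [← h, setIntegral_map hs hf.aestronglyMeasurable hAm.aemeasurable]
  rfl

theorem integral_apply_simplexLaw [Nonempty ι] (p : ι) :
    ∫ z, z p ∂simplexLaw ρ = (Fintype.card ι : ℝ)⁻¹ := by
  classical
  have := isProbabilityMeasure_simplexLaw ρ
  have hint (q : ι) : Integrable (fun z : ι → ℝ => z q) (simplexLaw ρ) :=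
    integrable_of_continuous_simplexLaw ρ (continuous_apply q)
  have hsym (q : ι) : ∫ z, z q ∂simplexLaw ρ = ∫ z, z p ∂simplexLaw ρ := by
    simpa using integral_swap_simplexLaw ρ p q (continuous_apply p) Set.univ MeasurableSet.univ
  have hsum : ∑ q, ∫ z, z q ∂simplexLaw ρ = 1 := by
    rw [← integral_finsetSum _ fun q _ => hint q]
    calc ∫ z, ∑ q, z q ∂simplexLaw ρ = ∫ _, (1 : ℝ) ∂simplexLaw ρ :=
          integral_congr_ae ((ae_mem_stdSimplex ρ).mono fun z hz => hz.2)
      _ = 1 := by simp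
  simp only [hsym, Finset.sum_const, Finset.card_univ, nsmul_eq_mul] at hsum
  exact eq_inv_of_mul_eq_one_right hsum

/-- A function invariant under exchanging two coordinates has half of its integral on either
side of the diagonal. -/
theorem setIntegral_halfspace_simplexLaw [Nonempty ι] [DecidableEq ι] {p q : ι} (hpq : p ≠ q)
    {f : (ι → ℝ) → ℝ} (hf : Continuous f) (hsymm : ∀ z, f (z ∘ Equiv.swap p q) = f z) :
    ∫ z in {z | z q ≤ z p}, f z ∂simplexLaw ρ = (∫ z, f z ∂simplexLaw ρ) / 2 := by
  have hs : MeasurableSet {z : ι → ℝ | z q ≤ z p} :=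
    measurableSet_le (measurable_pi_apply q) (measurable_pi_apply p)
  have h := integral_swap_simplexLaw ρ p q hf _ hs
  simp only [hsymm, Set.mem_ofPred_eq, Function.comp_apply, Equiv.swap_apply_left,
    Equiv.swap_apply_right] at h
  have hcompl : ∫ z in {z | z p ≤ z q}, f z ∂simplexLaw ρ =
      ∫ z in {z | z q ≤ z p}ᶜ, f z ∂simplexLaw ρ := by
    refine setIntegral_congr_set ?_
    have hne : ∀ᵐ z ∂simplexLaw ρ, z p ≠ z q := by
      rw [ae_iff]; simpa using simplexLaw_diagonal ρ hpq
    filter_upwards [hne] with z hz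
    refine propext ?_
    change z p ≤ z q ↔ ¬ z q ≤ z p
    rw [not_le]
    exact ⟨fun h => lt_of_le_of_ne h hz, le_of_lt⟩
  have := integral_add_compl hs (integrable_of_continuous_simplexLaw ρ hf)
  linarith

theorem sum_unfoldMap [DecidableEq ι] (p q : ι) (z : ι → ℝ) :
    ∑ i, unfoldMap p q z i = ∑ i, z i := by
  simp [unfoldMap_apply, Finset.sum_add_distrib, ← Finset.mul_sum]

theorem preimage_unfoldMap_stdSimplex [DecidableEq ι] {p q : ι} (hpq : p ≠ q) :
    unfoldMap p q ⁻¹' stdSimplex ℝ ι = stdSimplex ℝ ι ∩ {z | z q ≤ z p} := by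
  ext z
  simp only [stdSimplex, Set.mem_preimage, Set.mem_inter_iff, Set.mem_ofPred_eq, sum_unfoldMap]
  constructor
  · rintro ⟨h, hsum⟩
    have hp := h p
    have hq := h q
    rw [unfoldMap_left hpq] at hp
    rw [unfoldMap_right hpq] at hq
    refine ⟨⟨fun i => ?_, hsum⟩, by linarith⟩
    by_cases hip : i = p
    · subst hip; linarith
    by_cases hiq : i = q
    · subst hiq; linarith
    exact unfoldMap_of_ne hip hiq z ▸ h i
  · rintro ⟨⟨h, hsum⟩, hle⟩
    refine ⟨fun i => ?_, hsum⟩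
    by_cases hip : i = p
    · subst hip; rw [unfoldMap_left hpq]; linarith
    by_cases hiq : i = q
    · subst hiq; rw [unfoldMap_right hpq]; linarith [h i]
    exact (unfoldMap_of_ne hip hiq z).symm ▸ h i

theorem integral_sq_eq_two_mul [Nonempty ι] {p q : ι} (hpq : p ≠ q) :
    ∫ z, z p ^ 2 ∂simplexLaw ρ = 2 * ∫ z, z p * z q ∂simplexLaw ρ := by
  classical
  have := isProbabilityMeasure_simplexLaw ρ
  have hhalf : (simplexLaw ρ).real {z | z q ≤ z p} = 1 / 2 := by
    simpa using setIntegral_halfspace_simplexLaw ρ hpq (f := fun _ => 1) continuous_const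
      fun _ => rfl
  have hAm : Measurable (unfoldMap p q) :=
    (unfoldMap p q).continuous_of_finiteDimensional.measurable
  have hmap := map_restrict_simplexLaw ρ (unfoldMap p q) (unfoldMap_injective hpq)
    (sum_unfoldMap p q) _ (preimage_unfoldMap_stdSimplex hpq)
  have hcont : Continuous fun z : ι → ℝ => z p ^ 2 := by fun_prop
  have hunfold : ∫ z in {z | z q ≤ z p}, (z p - z q) ^ 2 ∂simplexLaw ρ =
      (1 / 2) * ∫ z, z p ^ 2 ∂simplexLaw ρ := by
    have := integral_map (μ := (simplexLaw ρ).restrict {z | z q ≤ z p}) hAm.aemeasurable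
      hcont.aestronglyMeasurable
    simp only [unfoldMap_left hpq] at this
    rw [← this, hmap, integral_smul_measure, ← hhalf]
    rfl
  have hswap := setIntegral_halfspace_simplexLaw ρ hpq (f := fun z => (z p - z q) ^ 2)
    (by fun_prop) fun z => by simp; ring
  have hsq : ∫ z, z q ^ 2 ∂simplexLaw ρ = ∫ z, z p ^ 2 ∂simplexLaw ρ := by
    simpa using integral_swap_simplexLaw ρ p q hcont Set.univ MeasurableSet.univ
  have hexp : ∫ z, (z p - z q) ^ 2 ∂simplexLaw ρ =
      ∫ z, z p ^ 2 ∂simplexLaw ρ + ∫ z, z q ^ 2 ∂simplexLaw ρ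
        - 2 * ∫ z, z p * z q ∂simplexLaw ρ := by
    rw [← integral_const_mul, ← integral_add, ← integral_sub]
    · exact integral_congr_ae (.of_forall fun z => by ring)
    all_goals exact integrable_of_continuous_simplexLaw ρ (by fun_prop)
  rw [hunfold] at hswap
  linarith

theorem integral_mul_simplexLaw [Nonempty ι] [DecidableEq ι] (p q : ι) :
    ∫ z, z p * z q ∂simplexLaw ρ =
      (if p = q then 2 else 1) / ((Fintype.card ι : ℝ) * (Fintype.card ι + 1)) := by
  have hN : (0 : ℝ) < Fintype.card ι := by exact_mod_cast Fintype.card_pos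
  have hoff (i : ι) : ∫ z, z p * z i ∂simplexLaw ρ =
      (if p = i then 2 else 1) * ((∫ z, z p ^ 2 ∂simplexLaw ρ) / 2) := by
    split_ifs with h
    · subst h
      simp only [← sq]
      ring
    · rw [integral_sq_eq_two_mul ρ h]
      ring
  have hsum : ∑ i, ∫ z, z p * z i ∂simplexLaw ρ = (Fintype.card ι : ℝ)⁻¹ := by
    rw [← integral_apply_simplexLaw ρ p, ← integral_finsetSum _ fun i _ =>
      integrable_of_continuous_simplexLaw ρ (by fun_prop)]
    refine integral_congr_ae ((ae_mem_stdSimplex ρ).mono fun z hz => ?_)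
    simp only [← Finset.mul_sum, hz.2, mul_one]
  simp only [hoff, ← Finset.sum_mul, sum_ite_eq_two_one] at hsum
  rw [hoff]
  have : (∫ z, z p ^ 2 ∂simplexLaw ρ) / 2 =
      1 / ((Fintype.card ι : ℝ) * (Fintype.card ι + 1)) := by
    field_simp at hsum ⊢
    linarith
  rw [this]
  ring

end Moments

section Weighted

variable {ι : Type*}

/-- Multiplication of the coordinates by nonzero weights. -/
noncomputable def weightEquiv [Finite ι] (w : ι → ℝ) (hw : ∀ i, w i ≠ 0) :
    EuclideanSpace ℝ ι ≃L[ℝ] (ι → ℝ) :=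
  (EuclideanSpace.equiv ι ℝ).trans
    (LinearEquiv.piCongrRight fun i =>
      LinearEquiv.smulOfNeZero ℝ ℝ (w i) (hw i)).toContinuousLinearEquiv

theorem weightEquiv_apply [Finite ι] (w : ι → ℝ) (hw : ∀ i, w i ≠ 0) (x : EuclideanSpace ℝ ι)
    (i : ι) : weightEquiv w hw x i = w i * x i := rfl

theorem finrank_sumZero [Fintype ι] [Nonempty ι] :
    (Module.finrank ℝ (sumZero ι) : ℝ) = Fintype.card ι - 1 := by
  have hne : (∑ i, LinearMap.proj i : (ι → ℝ) →ₗ[ℝ] ℝ) ≠ 0 := fun h => by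
    have := LinearMap.congr_fun h (barycenter ι)
    simp [barycenter] at this
  have := Module.Dual.finrank_ker_add_one_of_ne_zero hne
  rw [Module.finrank_pi] at this
  rw [eq_sub_iff_add_eq, sumZero]
  exact_mod_cast this

theorem exists_map_uniformOn_eq_simplexLaw [Fintype ι] [Nonempty ι] (w : ι → ℝ)
    (hw : ∀ i, 0 < w i) :
    ∃ ρ : Measure (sumZero ι), ρ.IsAddHaarMeasure ∧
      (uniformOn (Fintype.card ι - 1 : ℝ)
        {t : EuclideanSpace ℝ ι | (∀ p, 0 ≤ t p) ∧ ∑ p, w p * t p = 1}).map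
          (weightEquiv w fun i => (hw i).ne') = simplexLaw ρ := by
  set D := weightEquiv w fun i => (hw i).ne' with hD
  let V : Submodule ℝ (EuclideanSpace ℝ ι) := (sumZero ι).comap (D.toLinearEquiv : _ →ₗ[ℝ] _)
  let e : V ≃L[ℝ] sumZero ι := (D.toLinearEquiv.ofSubmodule' (sumZero ι)).toContinuousLinearEquiv
  have hfin : (Module.finrank ℝ V : ℝ) = Fintype.card ι - 1 := by
    rw [e.toLinearEquiv.finrank_eq, finrank_sumZero]
  let m : Measure V := μH[Module.finrank ℝ V]
  refine ⟨m.map e, e.isAddHaarMeasure_map m, ?_⟩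
  set S : Set (EuclideanSpace ℝ ι) := {t | (∀ p, 0 ≤ t p) ∧ ∑ p, w p * t p = 1} with hSdef
  have hS : S = D ⁻¹' stdSimplex ℝ ι := by
    ext x
    refine and_congr (forall_congr' fun i => ?_) Iff.rfl
    rw [hD, weightEquiv_apply, mul_nonneg_iff_of_pos_left (hw i)]
  have hDm : Measurable D := D.continuous.measurable
  have hstd := (isClosed_stdSimplex ℝ ι).measurableSet
  have hSm : MeasurableSet S := hS ▸ hDm hstd
  let f : V → EuclideanSpace ℝ ι := fun v => D.symm (barycenter ι) + v
  have hf : Isometry f := (isometry_add_left _).comp isometry_subtype_coe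
  have hmap : m.map f = (μH[Module.finrank ℝ V] : Measure _).restrict (Set.range f) :=
    hf.map_hausdorffMeasure (.inl (by positivity))
  have hrange : S ⊆ Set.range f := fun x hx => by
    refine ⟨⟨x - D.symm (barycenter ι), ?_⟩, by simp [f]⟩
    have : ∑ i, D x i = 1 := hx.2
    simp [V, mem_sumZero, Finset.sum_sub_distrib, this, sum_barycenter]
  have hplane : planeMeasure (m.map e) = (m.map f).map D := by
    rw [planeMeasure, Measure.map_map measurable_barycenter_add e.continuous.measurable,
      Measure.map_map hDm hf.continuous.measurable]
    congr 1
    funext v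
    simp [f, e]
    rfl
  have hrestrict : (planeMeasure (m.map e)).restrict (stdSimplex ℝ ι) =
      ((μH[Module.finrank ℝ V] : Measure _).restrict S).map D := by
    rw [hplane, Measure.restrict_map hDm hstd, ← hS, hmap, Measure.restrict_restrict hSm,
      Set.inter_eq_left.2 hrange]
  have hmass : planeMeasure (m.map e) (stdSimplex ℝ ι) =
      (μH[Module.finrank ℝ V] : Measure _) S := by
    rw [← Measure.restrict_apply_univ, hrestrict, Measure.map_apply hDm .univ, Set.preimage_univ,
      Measure.restrict_apply_univ]
  rw [uniformOn, simplexLaw, ProbabilityTheory.cond, hmass, hrestrict, Measure.map_smul, ← hfin]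

end Weighted

/-- Let `X = (X_{j,l})` be uniformly distributed on the weighted simplex
`Δ_k̄ = {t ∈ ℝ^{kr} : t_{j,l} ≥ 0, ∑_{j,l} j · t_{j,l} = 1}` and `Y j = ∑ l, X (j,l)`.
Then `E[Y j] = 1/(jk)`, `E[Y j ^ 2] = (r+1)/(j² k (kr+1))`, and in particular
`E[Y j ^ 2] ≤ 2/(j² k²)`.  (Here the index `j : Fin k` carries the weight `j + 1`.) -/
theorem stmt6 (k r : ℕ) (hk : 1 ≤ k) (hr : 1 ≤ r)
    (μ : Measure (EuclideanSpace ℝ (Fin k × Fin r)))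
    (hμ : μ = uniformOn ((k * r : ℕ) - 1 : ℝ)
        {t : EuclideanSpace ℝ (Fin k × Fin r) |
          (∀ p, 0 ≤ t p) ∧ ∑ p : Fin k × Fin r, ((p.1 : ℕ) + 1 : ℝ) * t p = 1})
    (j : Fin k) :
    (∫ x, (∑ l, x (j, l)) ∂μ) = 1 / (((j : ℕ) + 1 : ℝ) * k) ∧
    (∫ x, (∑ l, x (j, l)) ^ 2 ∂μ)
      = ((r : ℝ) + 1) / (((j : ℕ) + 1 : ℝ) ^ 2 * k * ((k : ℝ) * r + 1)) ∧
    (∫ x, (∑ l, x (j, l)) ^ 2 ∂μ) ≤ 2 / (((j : ℕ) + 1 : ℝ) ^ 2 * (k : ℝ) ^ 2) := by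
  have : NeZero k := ⟨by omega⟩
  have : NeZero r := ⟨by omega⟩
  let w : Fin k × Fin r → ℝ := fun p => (p.1 : ℕ) + 1
  have hw : ∀ p, 0 < w p := fun p => by positivity
  obtain ⟨ρ, hρ, hmap⟩ := exists_map_uniformOn_eq_simplexLaw w hw
  set D := weightEquiv w fun i => (hw i).ne' with hD
  have hcard : (Fintype.card (Fin k × Fin r) : ℝ) = k * r := by simp
  have hμD : μ.map D = simplexLaw ρ := by
    rw [← hmap, hμ, hcard, Nat.cast_mul]
  have hj : (0 : ℝ) < (j : ℕ) + 1 := by positivity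
  have hk' : (1 : ℝ) ≤ k := by exact_mod_cast hk
  have hr' : (1 : ℝ) ≤ r := by exact_mod_cast hr
  have hk0 : (0 : ℝ) < k := by linarith
  have hr0 : (0 : ℝ) < r := by linarith
  have htransfer (f : (Fin k × Fin r → ℝ) → ℝ) (hf : Continuous f) :
      ∫ x, f (D x) ∂μ = ∫ z, f z ∂simplexLaw ρ := by
    rw [← hμD, integral_map D.continuous.measurable.aemeasurable hf.aestronglyMeasurable]
  have hY (x : EuclideanSpace ℝ (Fin k × Fin r)) :
      ∑ l, x (j, l) = ((j : ℕ) + 1 : ℝ)⁻¹ * ∑ l, D x (j, l) := by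
    simp only [hD, weightEquiv_apply, w, ← Finset.mul_sum]
    field_simp
  have hfirst : ∫ z, ∑ l, z (j, l) ∂simplexLaw ρ = 1 / k := by
    rw [integral_finsetSum _ fun l _ => integrable_of_continuous_simplexLaw ρ (by fun_prop)]
    simp only [integral_apply_simplexLaw, hcard, Finset.sum_const, Finset.card_univ,
      Fintype.card_fin, nsmul_eq_mul]
    field_simp
  have hsecond : ∫ z, (∑ l, z (j, l)) ^ 2 ∂simplexLaw ρ =
      ((r : ℝ) + 1) / (k * ((k : ℝ) * r + 1)) := by
    simp only [sq, Finset.sum_mul_sum]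
    rw [integral_finsetSum _ fun l _ => integrable_of_continuous_simplexLaw ρ (by fun_prop)]
    have hrow (l : Fin r) : ∫ z, ∑ l', z (j, l) * z (j, l') ∂simplexLaw ρ =
        ((r : ℝ) + 1) / ((k * r : ℝ) * (k * r + 1)) := by
      rw [integral_finsetSum _ fun l _ => integrable_of_continuous_simplexLaw ρ (by fun_prop)]
      simp only [integral_mul_simplexLaw, hcard, Prod.mk.injEq, true_and, ← Finset.sum_div]
      rw [sum_ite_eq_two_one, Fintype.card_fin]
    simp only [hrow, Finset.sum_const, Finset.card_univ, Fintype.card_fin, nsmul_eq_mul]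
    field_simp
  have hE2 : ∫ x, (∑ l, x (j, l)) ^ 2 ∂μ
      = ((r : ℝ) + 1) / (((j : ℕ) + 1 : ℝ) ^ 2 * k * ((k : ℝ) * r + 1)) := by
    simp only [hY, mul_pow, integral_const_mul]
    rw [htransfer (fun z => (∑ l, z (j, l)) ^ 2) (by fun_prop), hsecond]
    field_simp
  refine ⟨?_, hE2, ?_⟩
  · simp only [hY, integral_const_mul]
    rw [htransfer (fun z => ∑ l, z (j, l)) (by fun_prop), hfirst]
    field_simp
  · rw [hE2, div_le_div_iff₀ (by positivity) (by positivity)]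
    have : ((r : ℝ) + 1) * k ≤ 2 * (k * r + 1) := by nlinarith
    have hc : (0 : ℝ) ≤ ((j : ℕ) + 1 : ℝ) ^ 2 * k := by positivity
    nlinarith [mul_le_mul_of_nonneg_left this hc]
end

section
/- Let k, r ≥ 1 be integers and let d_1, …, d_r ∈ ℝ. Let X = (X_{j,l}) be uniformly distributed on Δ_k̄ and define A(X) = Σ_{j=1}^k Σ_{l=1}^r X_{j,l} · d_l. Let T = (T_1,…,T_r) be uniformly distributed on the standard simplex Δ^{r−1} and set S = Σ_{l=1}^r d_l T_l. Then Var[A(X)] ≤ (2/k²) · (Σ_{j=1}^k 1/j²) · E[S²] ≤ (π²/(3k²)) · E[S²]. -/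
open MeasureTheory

open Module in
/-- The Hausdorff measure of a subset of the affine hyperplane `φ = 1` can be computed in the linear
hyperplane `ker φ`. -/
theorem hausdorffMeasure_eq_ker {E : Type*}
    [NormedAddCommGroup E] [NormedSpace ℝ E] [MeasurableSpace E] [BorelSpace E]
    (φ : E →ₗ[ℝ] ℝ) {m : ℝ} (hm : 0 ≤ m) {p : E} (hp : φ p = 1) {S : Set E}
    (hS : S ⊆ {x | φ x = 1}) :
    S = (p + ·) '' ((↑) '' {w : LinearMap.ker φ | p + (w : E) ∈ S} : Set E) ∧
      μH[m] S = μH[m] {w : LinearMap.ker φ | p + (w : E) ∈ S} := by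
  have hSK : S = (p + ·) '' ((↑) '' {w : LinearMap.ker φ | p + (w : E) ∈ S} : Set E) := by
    ext x
    constructor
    · intro hx
      refine ⟨x - p, ⟨⟨x - p, ?_⟩, ?_, rfl⟩, by simp⟩
      · have : φ x = 1 := hS hx
        simp [hp, this]
      · simpa using hx
    · rintro ⟨_, ⟨w, hw, rfl⟩, rfl⟩
      exact hw
  refine ⟨hSK, ?_⟩
  conv_lhs => rw [hSK]
  have := (IsometryEquiv.addLeft p).hausdorffMeasure_image m
    ((↑) '' {w : LinearMap.ker φ | p + (w : E) ∈ S} : Set E)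
  exact this.trans (isometry_subtype_coe.hausdorffMeasure_image (Or.inl hm) _)

open Module in
/-- An injective linear map scales the Hausdorff measure on an affine hyperplane of codimension one
by a constant. -/
theorem exists_hausdorffMeasure_image_eq_mul {E F : Type*}
    [NormedAddCommGroup E] [InnerProductSpace ℝ E] [FiniteDimensional ℝ E]
    [MeasurableSpace E] [BorelSpace E]
    [NormedAddCommGroup F] [InnerProductSpace ℝ F] [MeasurableSpace F] [BorelSpace F]
    (φ : E →ₗ[ℝ] ℝ) {m : ℝ} (hm : m = finrank ℝ (LinearMap.ker φ)) (L : E →ₗ[ℝ] F)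
    (hL : Function.Injective L) {p : E} (hp : φ p = 1) :
    ∃ c : ENNReal, c ≠ 0 ∧ c ≠ ⊤ ∧
      ∀ S : Set E, S ⊆ {x | φ x = 1} → μH[m] (L '' S) = c * μH[m] S := by
  set f := L ∘ₗ (LinearMap.ker φ).subtype
  have hker : LinearMap.ker f = ⊥ :=
    LinearMap.ker_eq_bot.2 (hL.comp (Submodule.injective_subtype _))
  have hdet : 0 < f.normDet :=
    lt_of_le_of_ne f.normDet_nonneg (Ne.symm ((f.normDet_ne_zero_tfae.out 0 1).2 hker))
  refine ⟨ENNReal.ofReal f.normDet, by simpa using hdet, ENNReal.ofReal_ne_top, fun S hS => ?_⟩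
  obtain ⟨hSK, hμ⟩ := hausdorffMeasure_eq_ker φ (hm ▸ Nat.cast_nonneg _ : 0 ≤ m) hp hS
  subst hm
  have hLS : L '' S = IsometryEquiv.addLeft (L p) ''
      (f '' {w : LinearMap.ker φ | p + (w : E) ∈ S}) := by
    conv_lhs => rw [hSK]
    simp [Set.image_image, f]
  rw [hLS, IsometryEquiv.hausdorffMeasure_image, f.hausdorffMeasure_image, hμ]

open Module in
/-- Injective linear maps send uniform measures on subsets of an affine hyperplane to uniform
measures. -/
theorem uniformOn_image {E F : Type*}
    [NormedAddCommGroup E] [InnerProductSpace ℝ E] [FiniteDimensional ℝ E]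
    [MeasurableSpace E] [BorelSpace E]
    [NormedAddCommGroup F] [InnerProductSpace ℝ F] [MeasurableSpace F] [BorelSpace F]
    (φ : E →ₗ[ℝ] ℝ) {m : ℝ} (hm : m = finrank ℝ (LinearMap.ker φ)) (L : E →ₗ[ℝ] F)
    (hL : Function.Injective L) {P : Set E} (hP : P ⊆ {x | φ x = 1}) :
    uniformOn m (L '' P) = (uniformOn m P).map L := by
  have hLm : Measurable L := L.continuous_of_finiteDimensional.measurable
  rcases P.eq_empty_or_nonempty with rfl | ⟨p, hp⟩
  · simp [uniformOn]
  obtain ⟨c, hc0, hct, hc⟩ := exists_hausdorffMeasure_image_eq_mul φ hm L hL (hP hp)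
  ext S hS
  rw [Measure.map_apply hLm hS]
  simp only [uniformOn, Measure.smul_apply, smul_eq_mul]
  rw [Measure.restrict_apply hS, Measure.restrict_apply (hLm hS), hc P hP,
    show S ∩ L '' P = L '' (L ⁻¹' S ∩ P) by rw [Set.image_preimage_inter],
    hc _ (Set.inter_subset_right.trans hP),
    ENNReal.mul_inv (Or.inl hc0) (Or.inl hct), mul_mul_mul_comm, ENNReal.inv_mul_cancel hc0 hct,
    one_mul]

section Simplex

variable {ι : Type*} [Fintype ι]

/-- The standard simplex as a subset of Euclidean space. -/
def euclideanSimplex (ι : Type*) [Fintype ι] : Set (EuclideanSpace ℝ ι) :=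
  {t | (∀ i, 0 ≤ t i) ∧ ∑ i, t i = 1}

/-- The uniform measure on the standard simplex. -/
noncomputable def simplexMeasure (ι : Type*) [Fintype ι] : Measure (EuclideanSpace ℝ ι) :=
  uniformOn ((Fintype.card ι : ℝ) - 1) (euclideanSimplex ι)

/-- The sum of the coordinates as a linear form. -/
noncomputable def coordSum (ι : Type*) [Fintype ι] : EuclideanSpace ℝ ι →ₗ[ℝ] ℝ where
  toFun x := ∑ i, x i
  map_add' x y := by simp [Finset.sum_add_distrib]
  map_smul' c x := by simp [Finset.mul_sum]

@[simp]
theorem coordSum_apply (x : EuclideanSpace ℝ ι) : coordSum ι x = ∑ i, x i := rfl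

theorem euclideanSimplex_subset : euclideanSimplex ι ⊆ {x | coordSum ι x = 1} :=
  fun _ hx => hx.2

theorem isCompact_euclideanSimplex : IsCompact (euclideanSimplex ι) := by
  have h := (isCompact_stdSimplex ℝ ι).image (PiLp.continuous_toLp 2 (fun _ : ι => ℝ))
  convert h using 1
  ext x
  constructor
  · intro hx
    exact ⟨x.ofLp, hx, rfl⟩
  · rintro ⟨y, hy, rfl⟩
    exact hy

/-- The barycentre of the standard simplex. -/
noncomputable def simplexCenter (ι : Type*) [Fintype ι] : EuclideanSpace ℝ ι :=
  WithLp.toLp 2 fun _ => (Fintype.card ι : ℝ)⁻¹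

theorem coordSum_simplexCenter [Nonempty ι] : coordSum ι (simplexCenter ι) = 1 := by
  simp [simplexCenter]

theorem card_sub_one_eq_finrank [Nonempty ι] :
    (Fintype.card ι : ℝ) - 1 = Module.finrank ℝ (LinearMap.ker (coordSum ι)) := by
  have hne : coordSum ι ≠ 0 := by
    intro h
    simpa [h] using coordSum_simplexCenter (ι := ι)
  have := Module.Dual.finrank_ker_add_one_of_ne_zero (f := coordSum ι) hne
  rw [finrank_euclideanSpace] at this
  rw [← this]
  push_cast
  ring

theorem hausdorffMeasure_simplex_ne_zero [Nonempty ι] :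
    μH[(Fintype.card ι : ℝ) - 1] (euclideanSimplex ι) ≠ 0 := by
  have hm := card_sub_one_eq_finrank (ι := ι)
  rw [hm, (hausdorffMeasure_eq_ker (coordSum ι) (by positivity) coordSum_simplexCenter
    euclideanSimplex_subset).2]
  set O : Set (LinearMap.ker (coordSum ι)) :=
    {w | ∀ i, 0 < (simplexCenter ι + (w : EuclideanSpace ℝ ι)) i}
  have hO : IsOpen O := by
    simp only [O, Set.ofPred_forall]
    refine isOpen_iInter_of_finite fun i => isOpen_lt continuous_const ?_
    fun_prop
  have hne : O.Nonempty := by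
    refine ⟨0, fun i => ?_⟩
    simp [simplexCenter, Fintype.card_pos]
  refine fun h => (hO.measure_pos (μH[Module.finrank ℝ (LinearMap.ker (coordSum ι))]) hne).ne'
    (measure_mono_null (fun w hw => ?_) h)
  have h1 : coordSum ι (simplexCenter ι + w) = 1 := by
    rw [map_add, coordSum_simplexCenter, w.2, add_zero]
  exact ⟨fun i => (hw i).le, h1⟩

theorem hausdorffMeasure_simplex_ne_top [Nonempty ι] :
    μH[(Fintype.card ι : ℝ) - 1] (euclideanSimplex ι) ≠ ⊤ := by
  have hm := card_sub_one_eq_finrank (ι := ι)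
  rw [hm, (hausdorffMeasure_eq_ker (coordSum ι) (by positivity) coordSum_simplexCenter
    euclideanSimplex_subset).2]
  refine IsCompact.measure_ne_top ?_
  have hemb : Topology.IsClosedEmbedding
      (fun w : LinearMap.ker (coordSum ι) => simplexCenter ι + (w : EuclideanSpace ℝ ι)) :=
    (Homeomorph.addLeft (simplexCenter ι)).isClosedEmbedding.comp
      (LinearMap.ker (coordSum ι)).closed_of_finiteDimensional.isClosedEmbedding_subtypeVal
  exact hemb.isCompact_preimage isCompact_euclideanSimplex

instance [Nonempty ι] : IsProbabilityMeasure (simplexMeasure ι) :=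
  ⟨by simp [simplexMeasure, uniformOn, ENNReal.inv_mul_cancel hausdorffMeasure_simplex_ne_zero
    hausdorffMeasure_simplex_ne_top]⟩

theorem ae_mem_euclideanSimplex : ∀ᵐ x ∂simplexMeasure ι, x ∈ euclideanSimplex ι :=
  Measure.ae_smul_measure (ae_restrict_mem isCompact_euclideanSimplex.measurableSet) _

theorem simplexMeasure_diagonal [Nonempty ι] [DecidableEq ι] {a b : ι} (hab : a ≠ b) :
    simplexMeasure ι {x | x a = x b} = 0 := by
  have hmeas : MeasurableSet {x : EuclideanSpace ℝ ι | x a = x b} :=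
    (isClosed_eq (by fun_prop) (by fun_prop)).measurableSet
  simp only [simplexMeasure, uniformOn, Measure.smul_apply, smul_eq_mul]
  rw [Measure.restrict_apply hmeas, card_sub_one_eq_finrank, (hausdorffMeasure_eq_ker (coordSum ι)
    (by positivity) coordSum_simplexCenter
    (Set.inter_subset_right.trans euclideanSimplex_subset)).2]
  refine mul_eq_zero_of_right _ ?_
  let V : Submodule ℝ (LinearMap.ker (coordSum ι)) :=
    { carrier := {w | (w : EuclideanSpace ℝ ι) a = (w : EuclideanSpace ℝ ι) b}
      add_mem' := by
        intro x y hx hy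
        simp_all
      zero_mem' := by simp
      smul_mem' := by
        intro c x hx
        simp_all }
  have hV : V ≠ ⊤ := by
    intro h
    have hw : EuclideanSpace.single a (1 : ℝ) - EuclideanSpace.single b 1 ∈
        LinearMap.ker (coordSum ι) := by
      simp [LinearMap.mem_ker]
    have : (⟨_, hw⟩ : LinearMap.ker (coordSum ι)) ∈ V := h ▸ Submodule.mem_top
    have h2 : (EuclideanSpace.single a (1 : ℝ) - EuclideanSpace.single b 1 : EuclideanSpace ℝ ι) a =
      (EuclideanSpace.single a (1 : ℝ) - EuclideanSpace.single b 1 : EuclideanSpace ℝ ι) b := this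
    simp [hab, hab.symm] at h2
    norm_num at h2
  refine measure_mono_null (fun w hw => ?_) (Measure.addHaar_submodule
    (μH[Module.finrank ℝ (LinearMap.ker (coordSum ι))]) V hV)
  have h1 : (simplexCenter ι + (w : EuclideanSpace ℝ ι)) a =
    (simplexCenter ι + (w : EuclideanSpace ℝ ι)) b := hw.1
  have h2 : (w : EuclideanSpace ℝ ι) a = (w : EuclideanSpace ℝ ι) b := by
    simpa [simplexCenter] using h1
  exact h2

theorem Continuous.integrable_simplexMeasure [Nonempty ι] {f : EuclideanSpace ℝ ι → ℝ}
    (hf : Continuous f) : Integrable f (simplexMeasure ι) := by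
  obtain ⟨C, hC⟩ := isCompact_euclideanSimplex.exists_bound_of_continuousOn (f := f)
    hf.continuousOn
  exact Integrable.of_bound hf.aestronglyMeasurable C
    (ae_mem_euclideanSimplex.mono fun x hx => hC x hx)

theorem map_simplexMeasure [Nonempty ι] {F : Type*} [NormedAddCommGroup F] [InnerProductSpace ℝ F]
    [MeasurableSpace F] [BorelSpace F] (L : EuclideanSpace ℝ ι →ₗ[ℝ] F)
    (hL : Function.Injective L) :
    (simplexMeasure ι).map L = uniformOn ((Fintype.card ι : ℝ) - 1) (L '' euclideanSimplex ι) :=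
  (uniformOn_image (coordSum ι) card_sub_one_eq_finrank L hL euclideanSimplex_subset).symm

theorem swap_simplex_apply [DecidableEq ι] (a b i : ι) (x : EuclideanSpace ℝ ι) :
    LinearIsometryEquiv.piLpCongrLeft 2 ℝ ℝ (Equiv.swap a b) x i = x (Equiv.swap a b i) := by
  simp [LinearIsometryEquiv.piLpCongrLeft_apply, Equiv.piCongrLeft']

theorem map_swap_simplexMeasure [Nonempty ι] [DecidableEq ι] (a b : ι) :
    (simplexMeasure ι).map (LinearIsometryEquiv.piLpCongrLeft 2 ℝ ℝ (Equiv.swap a b)) =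
      simplexMeasure ι := by
  set e := LinearIsometryEquiv.piLpCongrLeft 2 ℝ ℝ (Equiv.swap a b)
  have he : ∀ x i, e x i = x (Equiv.swap a b i) := fun x i => swap_simplex_apply a b i x
  have hmem : ∀ x ∈ euclideanSimplex ι, e x ∈ euclideanSimplex ι := fun x hx => by
    refine ⟨fun i => he x i ▸ hx.1 _, ?_⟩
    simp_rw [he]
    rw [Equiv.sum_comp (Equiv.swap a b) fun i => x i]
    exact hx.2
  have himage : e.toLinearEquiv.toLinearMap '' euclideanSimplex ι = euclideanSimplex ι := by
    ext x
    constructor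
    · rintro ⟨y, hy, rfl⟩
      exact hmem y hy
    · intro hx
      refine ⟨e x, hmem x hx, ?_⟩
      ext i
      simp [he]
  have := map_simplexMeasure e.toLinearEquiv.toLinearMap e.injective
  rw [himage] at this
  exact this

theorem integral_simplex_swap [Nonempty ι] [DecidableEq ι] (a b : ι)
    {f : EuclideanSpace ℝ ι → ℝ} (hf : Continuous f) :
    ∫ x, f (LinearIsometryEquiv.piLpCongrLeft 2 ℝ ℝ (Equiv.swap a b) x) ∂simplexMeasure ι =
      ∫ x, f x ∂simplexMeasure ι := by
  conv_rhs => rw [← map_swap_simplexMeasure a b]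
  rw [integral_map (LinearIsometryEquiv.continuous _).aemeasurable hf.aestronglyMeasurable]

/-- The linear map sending the standard simplex onto its half where the `b`-th coordinate is at most
the `a`-th one. -/
noncomputable def simplexHalving [DecidableEq ι] (a b : ι) :
    EuclideanSpace ℝ ι →ₗ[ℝ] EuclideanSpace ℝ ι where
  toFun x := x + (x b / 2) • (EuclideanSpace.single a 1 - EuclideanSpace.single b 1)
  map_add' x y := by
    ext i
    simp
    ring
  map_smul' c x := by
    ext i
    simp
    ring

omit [Fintype ι] in
theorem simplexHalving_apply [DecidableEq ι] (a b i : ι) (x : EuclideanSpace ℝ ι) :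
    simplexHalving a b x i =
      x i + x b / 2 * ((if i = a then 1 else 0) - (if i = b then 1 else 0)) := by
  simp [simplexHalving]

omit [Fintype ι] in
theorem simplexHalving_injective [DecidableEq ι] {a b : ι} (hab : a ≠ b) :
    Function.Injective (simplexHalving a b) := by
  intro x y h
  have hi := fun i => congrArg (fun z : EuclideanSpace ℝ ι => z i) h
  simp only [simplexHalving_apply] at hi
  have hb := hi b
  simp [hab.symm] at hb
  have hb' : x b = y b := by linarith
  ext i
  have := hi i
  rw [hb'] at this
  linarith

theorem simplexHalving_image [DecidableEq ι] {a b : ι} (hab : a ≠ b) :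
    simplexHalving a b '' euclideanSimplex ι = euclideanSimplex ι ∩ {x | x b ≤ x a} := by
  ext y
  constructor
  · rintro ⟨x, hx, rfl⟩
    refine ⟨⟨fun i => ?_, ?_⟩, ?_⟩
    · rw [simplexHalving_apply]
      have h1 := hx.1 i
      have h2 := hx.1 b
      by_cases hib : i = b
      · subst hib
        simp [hab.symm]
        linarith
      · simp only [hib, if_false, sub_zero]
        positivity
    · simp [simplexHalving_apply, Finset.sum_add_distrib, ← Finset.mul_sum, hx.2]
    · have h1 := hx.1 a
      simp only [Set.mem_ofPred_eq, simplexHalving_apply]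
      simp [hab, hab.symm]
      linarith
  · rintro ⟨hy, hyab⟩
    have hyab' : y b ≤ y a := hyab
    refine ⟨y - y b • (EuclideanSpace.single a 1 - EuclideanSpace.single b 1),
      ⟨fun i => ?_, ?_⟩, ?_⟩
    · have h1 := hy.1 i
      have h2 := hy.1 b
      by_cases hia : i = a
      · subst hia
        simp [hab]
        linarith
      · by_cases hib : i = b
        · subst hib
          simp [hab.symm]
          linarith
        · simpa [Pi.single_apply, hia, hib] using h1
    · simp [Finset.sum_sub_distrib, ← Finset.mul_sum, hy.2]
    · ext i
      simp [simplexHalving_apply, hab.symm]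
      ring

theorem uniformOn_inter {E : Type*} [EMetricSpace E] [MeasurableSpace E] [BorelSpace E] {m : ℝ}
    {P Q : Set E} (hQ : MeasurableSet Q) (h0 : μH[m] P ≠ 0) (ht : μH[m] P ≠ ⊤) :
    uniformOn m (P ∩ Q) = (uniformOn m P Q)⁻¹ • (uniformOn m P).restrict Q := by
  simp only [uniformOn, Measure.smul_apply, smul_eq_mul, Measure.restrict_smul]
  rw [Measure.restrict_apply hQ, Measure.restrict_restrict hQ, smul_smul, Set.inter_comm Q,
    ENNReal.mul_inv (Or.inl (ENNReal.inv_ne_zero.2 ht)) (Or.inl (ENNReal.inv_ne_top.2 h0)),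
    mul_right_comm, ENNReal.inv_mul_cancel (ENNReal.inv_ne_zero.2 ht) (ENNReal.inv_ne_top.2 h0),
    one_mul]

theorem measurableSet_coord_le (a b : ι) :
    MeasurableSet {x : EuclideanSpace ℝ ι | x b ≤ x a} :=
  (isClosed_le (by fun_prop) (by fun_prop)).measurableSet

theorem compl_coord_le_ae_eq [Nonempty ι] [DecidableEq ι] {a b : ι} (hab : a ≠ b) :
    ({x | x b ≤ x a}ᶜ : Set (EuclideanSpace ℝ ι)) =ᵐ[simplexMeasure ι] {x | x a ≤ x b} := by
  have : ∀ᵐ x ∂simplexMeasure ι, x a ≠ x b := by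
    simpa [ae_iff] using simplexMeasure_diagonal hab
  filter_upwards [this] with x hx
  apply propext
  change ¬ (x b ≤ x a) ↔ x a ≤ x b
  rw [not_le]
  exact ⟨le_of_lt, fun h => lt_of_le_of_ne h hx⟩

theorem map_simplexHalving [Nonempty ι] [DecidableEq ι] {a b : ι} (hab : a ≠ b) :
    (simplexMeasure ι).map (simplexHalving a b) =
      (2 : ENNReal) • (simplexMeasure ι).restrict {x | x b ≤ x a} := by
  set Q := {x : EuclideanSpace ℝ ι | x b ≤ x a}
  have hQ : MeasurableSet Q := measurableSet_coord_le a b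
  have hsymm : simplexMeasure ι Qᶜ = simplexMeasure ι Q := by
    rw [measure_congr (compl_coord_le_ae_eq hab)]
    conv_rhs => rw [← map_swap_simplexMeasure a b]
    rw [Measure.map_apply (LinearIsometryEquiv.continuous _).measurable hQ]
    congr 1
    ext x
    simp [Q, swap_simplex_apply]
  have hhalf : 2 * simplexMeasure ι Q = 1 := by
    rw [two_mul]
    nth_rewrite 2 [← hsymm]
    rw [measure_add_measure_compl hQ, measure_univ]
  have hhalf' : (simplexMeasure ι Q)⁻¹ = 2 :=
    (ENNReal.eq_inv_of_mul_eq_one_left hhalf).symm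
  rw [map_simplexMeasure _ (simplexHalving_injective hab), simplexHalving_image hab]
  refine (uniformOn_inter hQ hausdorffMeasure_simplex_ne_zero
    hausdorffMeasure_simplex_ne_top).trans ?_
  exact congrArg (· • (simplexMeasure ι).restrict Q) hhalf'

/-- A continuous function that is symmetric in two coordinates has the same mean over the simplex as
its composition with the halving map. -/
theorem integral_simplexHalving [Nonempty ι] [DecidableEq ι] {a b : ι} (hab : a ≠ b)
    {f : EuclideanSpace ℝ ι → ℝ} (hf : Continuous f)
    (hsymm : ∀ x, f (LinearIsometryEquiv.piLpCongrLeft 2 ℝ ℝ (Equiv.swap a b) x) = f x) :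
    ∫ x, f (simplexHalving a b x) ∂simplexMeasure ι = ∫ x, f x ∂simplexMeasure ι := by
  have hh : Continuous (simplexHalving a b) := LinearMap.continuous_of_finiteDimensional _
  rw [← integral_map hh.aemeasurable hf.aestronglyMeasurable, map_simplexHalving hab,
    integral_smul_measure]
  have hQ := measurableSet_coord_le a b
  rw [← integral_add_compl hQ hf.integrable_simplexMeasure,
    setIntegral_congr_set (compl_coord_le_ae_eq hab)]
  have : ∫ x in {x | x b ≤ x a}, f x ∂simplexMeasure ι =
      ∫ x in {x | x a ≤ x b}, f x ∂simplexMeasure ι := by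
    conv_lhs => rw [← map_swap_simplexMeasure a b]
    rw [setIntegral_map hQ hf.aestronglyMeasurable
      (LinearIsometryEquiv.continuous _).aemeasurable]
    simp [hsymm, swap_simplex_apply]
  rw [← this]
  simp [two_mul]

theorem integral_simplex_coord [Nonempty ι] (a : ι) :
    ∫ x, x a ∂simplexMeasure ι = (Fintype.card ι : ℝ)⁻¹ := by
  classical
  have hint : ∀ i : ι, Integrable (fun x : EuclideanSpace ℝ ι => x i) (simplexMeasure ι) :=
    fun i => Continuous.integrable_simplexMeasure (by fun_prop)
  have heq : ∀ i, ∫ x, x i ∂simplexMeasure ι = ∫ x, x a ∂simplexMeasure ι := fun i => by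
    rw [← integral_simplex_swap a i (f := fun x => x a) (by fun_prop)]
    simp [swap_simplex_apply]
  have hsum : ∑ i, ∫ x, x i ∂simplexMeasure ι = 1 := by
    rw [← integral_finsetSum _ fun i _ => hint i,
      integral_congr_ae (ae_mem_euclideanSimplex.mono fun x hx => hx.2)]
    simp
  simp_rw [heq] at hsum
  rw [Finset.sum_const, Finset.card_univ, nsmul_eq_mul] at hsum
  exact eq_inv_of_mul_eq_one_right hsum

theorem integral_simplex_coord_mul_eq [Nonempty ι] [DecidableEq ι] (a b c : ι) :
    ∫ x, x a * x b ∂simplexMeasure ι =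
      (∫ x, x c ^ 2 ∂simplexMeasure ι) * ((1 + if a = b then 1 else 0) / 2) := by
  have heq : ∀ i, ∫ x, x i ^ 2 ∂simplexMeasure ι = ∫ x, x c ^ 2 ∂simplexMeasure ι := fun i => by
    rw [← integral_simplex_swap c i (f := fun x => x c ^ 2) (by fun_prop)]
    simp [swap_simplex_apply]
  by_cases hab : a = b
  · subst hab
    rw [← heq a]
    simp [pow_two]
  · have hint : ∀ i j : ι, Integrable (fun x : EuclideanSpace ℝ ι => x i * x j)
        (simplexMeasure ι) := fun i j => Continuous.integrable_simplexMeasure (by fun_prop)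
    have hint' : ∀ i : ι, Integrable (fun x : EuclideanSpace ℝ ι => x i ^ 2)
        (simplexMeasure ι) := fun i => Continuous.integrable_simplexMeasure (by fun_prop)
    have h := integral_simplexHalving hab (f := fun x => (x a - x b) ^ 2) (by fun_prop)
      (fun x => by simp [swap_simplex_apply]; ring)
    have h1 : ∀ x : EuclideanSpace ℝ ι,
        (simplexHalving a b x a - simplexHalving a b x b) ^ 2 = x a ^ 2 := fun x => by
      simp [simplexHalving_apply, hab, Ne.symm hab]
      ring
    have h2 : ∀ x : EuclideanSpace ℝ ι,
        (x a - x b) ^ 2 = x a ^ 2 + x b ^ 2 - 2 * (x a * x b) := fun x => by ring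
    simp_rw [h1, h2] at h
    rw [integral_sub (Continuous.integrable_simplexMeasure (by fun_prop))
      ((hint a b).const_mul 2), integral_add (hint' a) (hint' b), integral_const_mul, heq a,
      heq b] at h
    simp only [hab, if_false]
    linarith

theorem integral_simplex_sum_sum [Nonempty ι] (c : ι → ι → ℝ) :
    ∫ x, ∑ i, ∑ j, c i j * (x i * x j) ∂simplexMeasure ι =
      ∑ i, ∑ j, c i j * ∫ x, x i * x j ∂simplexMeasure ι := by
  rw [integral_finsetSum _ fun j _ => Continuous.integrable_simplexMeasure (by fun_prop)]
  refine Finset.sum_congr rfl fun i _ => ?_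
  rw [integral_finsetSum _ fun j _ => Continuous.integrable_simplexMeasure (by fun_prop)]
  simp_rw [integral_const_mul]

theorem integral_simplex_sq [Nonempty ι] (c : ι) :
    ∫ x, x c ^ 2 ∂simplexMeasure ι = 2 / ((Fintype.card ι : ℝ) * (Fintype.card ι + 1)) := by
  classical
  have hsum := integral_simplex_sum_sum (fun _ _ : ι => (1 : ℝ))
  rw [integral_congr_ae (g := fun _ => 1) (ae_mem_euclideanSimplex.mono fun x hx => by
    simp [← Finset.sum_mul_sum, hx.2])] at hsum
  simp_rw [integral_simplex_coord_mul_eq _ _ c, ← Finset.mul_sum, ← Finset.sum_div,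
    Finset.sum_add_distrib] at hsum
  simp at hsum
  have : (0 : ℝ) < Fintype.card ι := by exact_mod_cast Fintype.card_pos
  field_simp
  field_simp at hsum
  linarith

theorem integral_simplex_linear [Nonempty ι] (c : ι → ℝ) :
    ∫ x, ∑ i, c i * x i ∂simplexMeasure ι = (∑ i, c i) / Fintype.card ι := by
  rw [integral_finsetSum _ fun j _ => Continuous.integrable_simplexMeasure (by fun_prop)]
  simp_rw [integral_const_mul, integral_simplex_coord, ← Finset.sum_mul]
  rfl

theorem integral_simplex_linear_sq [Nonempty ι] (c : ι → ℝ) :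
    ∫ x, (∑ i, c i * x i) ^ 2 ∂simplexMeasure ι =
      (∑ i, c i ^ 2 + (∑ i, c i) ^ 2) / ((Fintype.card ι : ℝ) * (Fintype.card ι + 1)) := by
  classical
  have hexp : ∀ x : EuclideanSpace ℝ ι, (∑ i, c i * x i) ^ 2 =
      ∑ i, ∑ j, c i * c j * (x i * x j) := fun x => by
    rw [pow_two, Finset.sum_mul_sum]
    exact Finset.sum_congr rfl fun i _ => Finset.sum_congr rfl fun j _ => by ring
  simp_rw [hexp, integral_simplex_sum_sum,
    integral_simplex_coord_mul_eq _ _ (Classical.arbitrary ι), integral_simplex_sq]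
  have hterm : ∀ i j : ι, c i * c j * (2 / ((Fintype.card ι : ℝ) * (Fintype.card ι + 1)) *
      ((1 + if i = j then 1 else 0) / 2)) =
      (c i * c j + if i = j then c i * c j else 0) *
        ((Fintype.card ι : ℝ) * (Fintype.card ι + 1))⁻¹ := fun i j => by
    split_ifs <;> ring
  simp_rw [hterm, ← Finset.sum_mul, Finset.sum_add_distrib]
  rw [← Finset.sum_mul_sum]
  simp only [Finset.sum_ite_eq, Finset.mem_univ, if_true, div_eq_mul_inv, pow_two]
  ring

end Simplex

theorem two_div_sq_mul_sum_inv_sq_le (k : ℕ) {E : ℝ} (hE : 0 ≤ E) :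
    2 / (k : ℝ) ^ 2 * (∑ j ∈ Finset.range k, 1 / ((j : ℝ) + 1) ^ 2) * E ≤
      Real.pi ^ 2 / (3 * (k : ℝ) ^ 2) * E := by
  have hsum : ∑ j ∈ Finset.range k, 1 / ((j : ℝ) + 1) ^ 2 ≤ Real.pi ^ 2 / 6 := by
    have h := sum_le_hasSum (Finset.range (k + 1)) (fun i _ => by positivity) hasSum_zeta_two
    rw [Finset.sum_range_succ'] at h
    simpa using h
  calc _ ≤ 2 / (k : ℝ) ^ 2 * (Real.pi ^ 2 / 6) * E := by gcongr
    _ = _ := by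
      rw [show Real.pi ^ 2 / (3 * (k : ℝ) ^ 2) = 2 / (k : ℝ) ^ 2 * (Real.pi ^ 2 / 6) by
        rw [← div_div]; ring]

/-- Divide each coordinate by the corresponding weight. -/
noncomputable def divWeights {ι : Type*} (w : ι → ℝ) :
    EuclideanSpace ℝ ι →ₗ[ℝ] EuclideanSpace ℝ ι where
  toFun x := WithLp.toLp 2 fun i => x i / w i
  map_add' x y := by
    ext i
    simp [add_div]
  map_smul' c x := by
    ext i
    simp [mul_div_assoc]

@[simp]
theorem divWeights_apply {ι : Type*} (w : ι → ℝ) (x : EuclideanSpace ℝ ι) (i : ι) :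
    divWeights w x i = x i / w i := rfl

theorem divWeights_injective {ι : Type*} {w : ι → ℝ} (hw : ∀ i, 0 < w i) :
    Function.Injective (divWeights w) := by
  intro x y h
  ext i
  have := congrArg (fun z : EuclideanSpace ℝ ι => z i) h
  simpa [div_left_inj' (hw i).ne'] using this

/-- The uniform measure on a weighted simplex is the image of that on the standard simplex. -/
theorem uniformOn_weightedSimplex {ι : Type*} [Fintype ι] [Nonempty ι] {w : ι → ℝ}
    (hw : ∀ i, 0 < w i) :
    uniformOn ((Fintype.card ι : ℝ) - 1)
        {t : EuclideanSpace ℝ ι | (∀ i, 0 ≤ t i) ∧ ∑ i, w i * t i = 1} =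
      (simplexMeasure ι).map (divWeights w) := by
  rw [map_simplexMeasure _ (divWeights_injective hw)]
  congr 1
  ext t
  constructor
  · rintro ⟨h0, h1⟩
    refine ⟨WithLp.toLp 2 fun i => w i * t i, ⟨fun i => mul_nonneg (hw i).le (h0 i), h1⟩, ?_⟩
    ext i
    simp [(hw i).ne']
  · rintro ⟨x, ⟨h0, h1⟩, rfl⟩
    refine ⟨fun i => div_nonneg (h0 i) (hw i).le, ?_⟩
    simpa [mul_div_cancel₀, mul_div_cancel_left₀, (hw _).ne', mul_div_assoc'] using h1

/-- The elementary inequality behind the variance bound. -/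
theorem variance_bound {k r H D : ℝ} (hk : 1 ≤ k) (hr : 1 ≤ r) (hH : 0 ≤ H) (hD : 0 ≤ D)
    (s t : ℝ) :
    (H * D + s ^ 2) / (k * r * (k * r + 1)) - (s / (k * r)) ^ 2 ≤
      2 / k ^ 2 * H * ((D + t ^ 2) / (r * (r + 1))) := by
  have hk0 : 0 < k := by linarith
  have hr0 : 0 < r := by linarith
  have hn : 0 < k * r := mul_pos hk0 hr0
  have h1 : s ^ 2 / (k * r * (k * r + 1)) ≤ (s / (k * r)) ^ 2 := by
    rw [div_pow]
    gcongr
    nlinarith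
  have h2 : H * D / (k * r * (k * r + 1)) ≤ H * D / (k ^ 2 * r ^ 2) := by
    refine div_le_div_of_nonneg_left (mul_nonneg hH hD) (by positivity) ?_
    nlinarith
  have h3 : H * D / (k ^ 2 * r ^ 2) ≤ H * D * (2 / (k ^ 2 * (r * (r + 1)))) := by
    rw [div_eq_mul_one_div]
    refine mul_le_mul_of_nonneg_left ?_ (mul_nonneg hH hD)
    rw [div_le_div_iff₀ (by positivity) (by positivity)]
    nlinarith [mul_nonneg (mul_nonneg (sq_nonneg k) hr0.le) (sub_nonneg.2 hr)]
  have h4 : 2 / k ^ 2 * H * (D / (r * (r + 1))) ≤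
      2 / k ^ 2 * H * ((D + t ^ 2) / (r * (r + 1))) := by
    gcongr
    nlinarith [sq_nonneg t]
  have h5 : H * D * (2 / (k ^ 2 * (r * (r + 1)))) = 2 / k ^ 2 * H * (D / (r * (r + 1))) := by
    field_simp
  rw [add_div]
  linarith

/-- Let `X` be uniform on the weighted simplex `Δ_k̄` and
`A(X) = ∑_{j,l} X_{j,l} d_l`; let `T` be uniform on the standard simplex `Δ^{r-1}` and
`S = ∑ l, d l * T l`. Then
`Var[A(X)] ≤ (2/k²) (∑_{j=1}^k 1/j²) E[S²] ≤ (π²/(3k²)) E[S²]`,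
where `Var[Z] = E[Z²] - E[Z]²`. -/
theorem stmt8 (k r : ℕ) (hk : 1 ≤ k) (hr : 1 ≤ r) (d : Fin r → ℝ)
    (μ : Measure (EuclideanSpace ℝ (Fin k × Fin r)))
    (hμ : μ = uniformOn ((k * r : ℕ) - 1 : ℝ)
        {t : EuclideanSpace ℝ (Fin k × Fin r) |
          (∀ p, 0 ≤ t p) ∧ ∑ p : Fin k × Fin r, ((p.1 : ℕ) + 1 : ℝ) * t p = 1})
    (ν : Measure (EuclideanSpace ℝ (Fin r)))
    (hν : ν = uniformOn ((r : ℝ) - 1)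
        {t : EuclideanSpace ℝ (Fin r) | (∀ i, 0 ≤ t i) ∧ ∑ i, t i = 1})
    (A : EuclideanSpace ℝ (Fin k × Fin r) → ℝ)
    (hA : ∀ x, A x = ∑ j, ∑ l, x (j, l) * d l)
    (ES2 : ℝ) (hES2 : ES2 = ∫ t, (∑ l, d l * t l) ^ 2 ∂ν) :
    (∫ x, A x ^ 2 ∂μ) - (∫ x, A x ∂μ) ^ 2
        ≤ 2 / (k : ℝ) ^ 2 * (∑ j ∈ Finset.range k, 1 / ((j : ℝ) + 1) ^ 2) * ES2 ∧
    2 / (k : ℝ) ^ 2 * (∑ j ∈ Finset.range k, 1 / ((j : ℝ) + 1) ^ 2) * ES2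
        ≤ Real.pi ^ 2 / (3 * (k : ℝ) ^ 2) * ES2 := by
  have : NeZero k := ⟨by omega⟩
  have : NeZero r := ⟨by omega⟩
  have hES2_eq : ES2 = (∑ l, d l ^ 2 + (∑ l, d l) ^ 2) / ((r : ℝ) * (r + 1)) := by
    have h := integral_simplex_linear_sq d
    simp only [simplexMeasure, euclideanSimplex, Fintype.card_fin] at h
    rw [hES2, hν, h]
  have hES2_nonneg : 0 ≤ ES2 := by rw [hES2_eq]; positivity
  refine ⟨?_, two_div_sq_mul_sum_inv_sq_le k hES2_nonneg⟩
  set w : Fin k × Fin r → ℝ := fun p => (p.1 : ℕ) + 1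
  have hw : ∀ p, 0 < w p := fun p => by positivity
  set c : Fin k × Fin r → ℝ := fun p => d p.2 / w p
  have hcard : (Fintype.card (Fin k × Fin r) : ℝ) = k * r := by simp
  have hμ_map : μ = (simplexMeasure (Fin k × Fin r)).map (divWeights w) := by
    rw [hμ, ← uniformOn_weightedSimplex hw, hcard]
    push_cast
    rfl
  have hAL : ∀ x, A (divWeights w x) = ∑ p, c p * x p := fun x => by
    rw [hA, Fintype.sum_prod_type]
    refine Finset.sum_congr rfl fun j _ => Finset.sum_congr rfl fun l _ => ?_
    simp only [divWeights_apply, c]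
    ring
  have hAc : Continuous A := by
    rw [funext hA]
    fun_prop
  have hLm : AEMeasurable (divWeights w) (simplexMeasure (Fin k × Fin r)) :=
    (LinearMap.continuous_of_finiteDimensional _).aemeasurable
  rw [hμ_map, integral_map hLm hAc.aestronglyMeasurable,
    integral_map hLm (f := fun x => A x ^ 2) (hAc.pow 2).aestronglyMeasurable]
  simp_rw [hAL]
  rw [integral_simplex_linear, integral_simplex_linear_sq, hcard, hES2_eq]
  have hc2 : ∑ p, c p ^ 2 =
      (∑ j ∈ Finset.range k, 1 / ((j : ℝ) + 1) ^ 2) * ∑ l, d l ^ 2 := by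
    rw [← Fin.sum_univ_eq_sum_range (fun j => 1 / ((j : ℝ) + 1) ^ 2), Fintype.sum_prod_type,
      Finset.sum_mul_sum]
    refine Finset.sum_congr rfl fun j _ => Finset.sum_congr rfl fun l _ => ?_
    simp only [c, w]
    rw [div_pow, div_eq_mul_one_div, mul_comm]
  rw [hc2]
  exact variance_bound (by exact_mod_cast hk) (by exact_mod_cast hr)
    (Finset.sum_nonneg fun j _ => by positivity) (Finset.sum_nonneg fun l _ => sq_nonneg _) _ _
end
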